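/- arXiv:2605.05497 — 2 statements merged into one kernel-verified Lean document; each statement's English description precedes it below -/
import Mathlib

section
/- Suppose additionally that there are real coverage boundaries β_t such that err_t = 0 whenever α_t < β_t and err_t = 1 whenever α_t > β_t. Set η⁻ = γ(1−α) and η⁺ = γα. Then for every t the deterministic bounds hold: 0 ≤ L_t ≤ γ(1−α)·𝟙{β_t ≤ η⁻} and 0 ≤ U_t ≤ γα·𝟙{β_t ≥ 1 − η⁺}. In particular, {L_t > 0} ⊆ {β_t ≤ η⁻} and {U_t > 0} ⊆ {β_t ≥ 1 − η⁺}. -/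
/-- With coverage boundaries `β_t` (coverage strictly below `β_t`,
miscoverage strictly above), setting `η⁻ = γ(1−α)` and `η⁺ = γα`, for every `t ≥ 1`:
`0 ≤ L_t ≤ γ(1−α)·𝟙{β_t ≤ η⁻}` and `0 ≤ U_t ≤ γα·𝟙{β_t ≥ 1 − η⁺}`; in particular
`L_t > 0 → β_t ≤ η⁻` and `U_t > 0 → β_t ≥ 1 − η⁺`. -/
theorem olcp_boundary_event_bounds
    (α γ : ℝ) (hα0 : 0 ≤ α) (hα1 : α ≤ 1) (hγ : 0 < γ)
    (err A z L U β : ℕ → ℝ)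
    (herr : ∀ t, 1 ≤ t → err t = 0 ∨ err t = 1)
    (hA1 : 0 ≤ A 1 ∧ A 1 ≤ 1)
    (hz : ∀ t, 1 ≤ t → z t = A t + γ * (α - err t))
    (hrec : ∀ t, 1 ≤ t → A (t + 1) = max 0 (min 1 (z t)))
    (hL : ∀ t, 1 ≤ t → L t = max (-(z t)) 0)
    (hU : ∀ t, 1 ≤ t → U t = max (z t - 1) 0)
    (hcov : ∀ t, 1 ≤ t → (A t < β t → err t = 0) ∧ (β t < A t → err t = 1)) :
    ∀ t, 1 ≤ t →
      (0 ≤ L t ∧ L t ≤ γ * (1 - α) * (if β t ≤ γ * (1 - α) then (1 : ℝ) else 0)) ∧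
      (0 ≤ U t ∧ U t ≤ γ * α * (if 1 - γ * α ≤ β t then (1 : ℝ) else 0)) ∧
      (0 < L t → β t ≤ γ * (1 - α)) ∧
      (0 < U t → 1 - γ * α ≤ β t) := by
  have hA : ∀ t, 1 ≤ t → 0 ≤ A t ∧ A t ≤ 1 := by
    intro t ht
    induction t, ht using Nat.le_induction with
    | base => exact hA1
    | succ n hn _ =>
      rw [hrec n hn]
      exact ⟨le_max_left _ _, max_le zero_le_one (min_le_left _ _)⟩
  intro t ht
  obtain ⟨hA0, hA1'⟩ := hA t ht
  have hzt := hz t ht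
  obtain ⟨hcov0, hcov1⟩ := hcov t ht
  have hlo : 0 ≤ γ * (1 - α) := mul_nonneg hγ.le (sub_nonneg.2 hα1)
  have hhi : 0 ≤ γ * α := mul_nonneg hγ.le hα0
  have hL0 : 0 ≤ L t := hL t ht ▸ le_max_right _ _
  have hU0 : 0 ≤ U t := hU t ht ▸ le_max_right _ _
  have hLle : L t ≤ γ * (1 - α) := by
    rw [hL t ht]
    refine max_le ?_ hlo
    rcases herr t ht with h | h <;> rw [h] at hzt <;> linarith
  have hUle : U t ≤ γ * α := by
    rw [hU t ht]
    refine max_le ?_ hhi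
    rcases herr t ht with h | h <;> rw [h] at hzt <;> linarith
  have hLpos : 0 < L t → β t ≤ γ * (1 - α) := by
    intro h
    rw [hL t ht, lt_max_iff, or_iff_left (lt_irrefl _)] at h
    by_contra! hβ
    rcases herr t ht with he | he
    · rw [he] at hzt
      linarith
    · rw [he] at hzt
      have := hcov0 (by linarith)
      linarith
  have hUpos : 0 < U t → 1 - γ * α ≤ β t := by
    intro h
    rw [hU t ht, lt_max_iff, or_iff_left (lt_irrefl _)] at h
    by_contra! hβ
    rcases herr t ht with he | he
    · rw [he] at hzt
      have := hcov1 (by linarith)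
      linarith
    · rw [he] at hzt
      linarith
  refine ⟨⟨hL0, ?_⟩, ⟨hU0, ?_⟩, hLpos, hUpos⟩
  · split_ifs with h
    · rwa [mul_one]
    · rw [mul_zero]
      exact not_lt.1 (mt hLpos h)
  · split_ifs with h
    · rwa [mul_one]
    · rw [mul_zero]
      exact not_lt.1 (mt hUpos h)
end

section
/- Let α ∈ [0,1] and β, θ ∈ ℝ, and define the pinball loss ℓ(β, θ) = α(β − θ) − min{0, β − θ}. Let e ∈ {0,1} satisfy e = 0 whenever θ < β and e = 1 whenever θ > β (either value is allowed when θ = β). Then e − α is a subgradient of the map θ ↦ ℓ(β, θ) at θ: for every θ′ ∈ ℝ, ℓ(β, θ′) ≥ ℓ(β, θ) + (e − α)(θ′ − θ). Consequently, the projected OLCP level update α_{t+1} = Π_{[0,1]}(α_t + γ(α − err_t)) is exactly projected online (sub)gradient descent on the pinball losses ℓ(β_t, ·) evaluated at the coverage-boundary levels β_t. -/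
/-- For the pinball loss `ℓ(β, θ) = α(β − θ) − min{0, β − θ}` with
`α ∈ [0,1]`, if `e ∈ {0,1}` satisfies `e = 0` whenever `θ < β` and `e = 1` whenever
`θ > β`, then `e − α` is a subgradient of `θ ↦ ℓ(β, θ)` at `θ`. Consequently the
projected OLCP update `α_{t+1} = Π_{[0,1]}(α_t + γ(α − err_t))` is exactly projected
online subgradient descent on the pinball losses: it coincides with
`Π_{[0,1]}(α_t − γ·(err_t − α))`, a projected step along the subgradient `err_t − α`. -/
theorem pinball_subgradient_olcp
    (α : ℝ) (hα0 : 0 ≤ α) (hα1 : α ≤ 1)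
    (β θ e : ℝ) (he : e = 0 ∨ e = 1)
    (he0 : θ < β → e = 0) (he1 : β < θ → e = 1) :
    (∀ θ' : ℝ,
      α * (β - θ') - min 0 (β - θ') ≥
        (α * (β - θ) - min 0 (β - θ)) + (e - α) * (θ' - θ)) ∧
    (∀ γ αt : ℝ,
      max 0 (min 1 (αt + γ * (α - e))) = max 0 (min 1 (αt - γ * (e - α)))) := by
  refine ⟨fun θ' => ?_, fun γ αt => by rw [← neg_sub e α, mul_neg, ← sub_eq_add_neg]⟩
  rcases he with rfl | rfl
  · have hθ : θ ≤ β := not_lt.mp fun h => zero_ne_one (he1 h)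
    rw [min_eq_left (sub_nonneg.mpr hθ)]
    linarith [min_le_left 0 (β - θ')]
  · have hθ : β ≤ θ := not_lt.mp fun h => one_ne_zero (he0 h)
    rw [min_eq_right (sub_nonpos.mpr hθ)]
    linarith [min_le_right 0 (β - θ')]
end
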